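/- Linear remainders are optimal: increment bound for admissible remainder functions (core of Lemma 3): Let p ≤ q in Fin n → ℝ (componentwise), let h : (Fin n → ℝ) → ℝ be continuous on Set.Icc p q, let m : Fin n → ℝ and S ⊆ Fin n be such that m j ≥ 0 for j ∈ S and m j ≤ 0 for j ∉ S, and suppose for every z ∈ Set.Icc p q: for j ∈ S, the Clarke lower directional derivative h_○(z, Pi.single j 1) ≥ (m j : EReal), and for j ∉ S, the Clarke upper directional derivative h°(z, Pi.single j 1) ≤ (m j : EReal). Define the opposite vertices ζ⁻ j := if j ∈ S then q j else p j and ζ⁺ j := if j ∈ S then p j else q j. Then h ζ⁻ - h ζ⁺ ≥ ∑ j, m j * (ζ⁻ j - ζ⁺ j), and the right-hand side equals ∑ j, |m j| * (q j - p j); hence among all admissible remainder functions the linear remainder z ↦ ∑ j, m j * z j yields the smallest remainder-form upper decomposition value. -/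

import Mathlib

/-- Clarke (generalized) upper directional derivative of `f` at `z` in direction `v`. -/
noncomputable def clarkeUpper {E : Type*} [NormedAddCommGroup E] [NormedSpace ℝ E]
    (f : E → ℝ) (z v : E) : EReal :=
  Filter.limsup
    (fun tl : E × ℝ => (((f (tl.1 + tl.2 • v) - f tl.1) / tl.2 : ℝ) : EReal))
    ((nhds z) ×ˢ (nhdsWithin 0 (Set.Ioi 0)))

/-- Clarke (generalized) lower directional derivative of `f` at `z` in direction `v`. -/
noncomputable def clarkeLower {E : Type*} [NormedAddCommGroup E] [NormedSpace ℝ E]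
    (f : E → ℝ) (z v : E) : EReal :=
  Filter.liminf
    (fun tl : E × ℝ => (((f (tl.1 + tl.2 • v) - f tl.1) / tl.2 : ℝ) : EReal))
    ((nhds z) ×ˢ (nhdsWithin 0 (Set.Ioi 0)))

open Filter Topology in
/-- A continuous function on `[a, b]` whose lower right Dini derivative is at least `c`
increases by at least `c * (b - a)`. -/
theorem mul_sub_le_sub_of_eventually_lt_quotient {f : ℝ → ℝ} {a b c : ℝ} (hab : a ≤ b)
    (hf : ContinuousOn f (Set.Icc a b))
    (hd : ∀ x ∈ Set.Icc a b, ∀ r < c, ∀ᶠ l in 𝓝[>] (0 : ℝ), r < (f (x + l) - f x) / l) :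
    c * (b - a) ≤ f b - f a := by
  have key := image_le_of_liminf_slope_right_le_deriv_boundary (f := fun x => -f x)
    (a := a) (b := b) hf.neg (B := fun x => -f a - c * (x - a)) (B' := fun _ => -c)
    (by simp) (by fun_prop)
    (fun x _ => by
      have h₁ := (((hasDerivAt_id x).sub_const a).const_mul c).const_sub (-f a)
      simpa using h₁.hasDerivWithinAt)
    (fun x hx r hr => by
      have h₁ := hd x ⟨hx.1, hx.2.le⟩ (-r) (by linarith)
      have h₂ : Tendsto (fun y => y - x) (𝓝[>] x) (𝓝[>] 0) := by
        refine tendsto_nhdsWithin_iff.2 ⟨?_, ?_⟩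
        · have : Tendsto (fun y => y - x) (𝓝 x) (𝓝 (x - x)) :=
            (continuous_id.sub continuous_const).tendsto x
          rw [sub_self] at this
          exact this.mono_left nhdsWithin_le_nhds
        · filter_upwards [self_mem_nhdsWithin] with y hy
          exact sub_pos.2 (Set.mem_Ioi.1 hy)
      refine Eventually.frequently ?_
      filter_upwards [h₂.eventually h₁] with y hy
      rw [add_sub_cancel] at hy
      have h₃ : slope (fun x => -f x) x y = -((f y - f x) / (y - x)) := by
        rw [slope_def_field]
        ring
      rw [h₃]
      linarith)
  have := key (Set.right_mem_Icc.2 hab)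
  linarith

open Filter Topology in
/-- A lower bound on the Clarke lower derivative bounds the one-sided difference quotients. -/
theorem eventually_lt_quotient_of_le_clarkeLower {E : Type*} [NormedAddCommGroup E]
    [NormedSpace ℝ E] {f : E → ℝ} {z v : E} {c r : ℝ} (hc : (c : EReal) ≤ clarkeLower f z v)
    (hr : r < c) : ∀ᶠ l in 𝓝[>] (0 : ℝ), r < (f (z + l • v) - f z) / l := by
  have h₁ := eventually_lt_of_lt_liminf ((EReal.coe_lt_coe_iff.2 hr).trans_le hc)
  have h₂ : Tendsto (fun l : ℝ => (z, l)) (𝓝[>] 0) (𝓝 z ×ˢ 𝓝[>] 0) :=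
    tendsto_const_nhds.prodMk tendsto_id
  filter_upwards [h₂.eventually h₁] with l hl
  exact EReal.coe_lt_coe_iff.1 hl

open Filter Topology in
/-- An upper bound on the Clarke upper derivative bounds the one-sided difference quotients. -/
theorem eventually_quotient_lt_of_clarkeUpper_le {E : Type*} [NormedAddCommGroup E]
    [NormedSpace ℝ E] {f : E → ℝ} {z v : E} {c r : ℝ} (hc : clarkeUpper f z v ≤ (c : EReal))
    (hr : c < r) : ∀ᶠ l in 𝓝[>] (0 : ℝ), (f (z + l • v) - f z) / l < r := by
  have h₁ := eventually_lt_of_limsup_lt (hc.trans_lt (EReal.coe_lt_coe_iff.2 hr))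
  have h₂ : Tendsto (fun l : ℝ => (z, l)) (𝓝[>] 0) (𝓝 z ×ˢ 𝓝[>] 0) :=
    tendsto_const_nhds.prodMk tendsto_id
  filter_upwards [h₂.eventually h₁] with l hl
  exact EReal.coe_lt_coe_iff.1 hl

theorem update_add_eq_add_smul_single {n : ℕ} (z : Fin n → ℝ) (j : Fin n) (x l : ℝ) :
    Function.update z j (x + l) = Function.update z j x + l • Pi.single j (1 : ℝ) := by
  ext i
  by_cases hi : i = j
  · subst hi
    simp
  · simp [hi]

theorem update_mem_Icc {n : ℕ} {p q z : Fin n → ℝ} (hz : z ∈ Set.Icc p q) {j : Fin n} {x : ℝ}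
    (hx : x ∈ Set.Icc (p j) (q j)) : Function.update z j x ∈ Set.Icc p q :=
  ⟨le_update_iff.2 ⟨hx.1, fun i _ => hz.1 i⟩, update_le_iff.2 ⟨hx.2, fun i _ => hz.2 i⟩⟩

theorem continuousOn_comp_update {n : ℕ} {p q z : Fin n → ℝ} {h : (Fin n → ℝ) → ℝ}
    (hh : ContinuousOn h (Set.Icc p q)) (hz : z ∈ Set.Icc p q) (j : Fin n) :
    ContinuousOn (fun x => h (Function.update z j x)) (Set.Icc (p j) (q j)) :=
  hh.comp (f := Function.update z j)
    (Continuous.continuousOn (continuous_const.update (f := fun _ : ℝ => z) j continuous_id))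
    fun _ hx => update_mem_Icc hz hx

/-- Increment of `h` along an edge under a lower bound on the Clarke lower derivative. -/
theorem mul_sub_le_sub_update_of_le_clarkeLower {n : ℕ} {p q z : Fin n → ℝ}
    {h : (Fin n → ℝ) → ℝ} {c : ℝ} {j : Fin n} (hh : ContinuousOn h (Set.Icc p q))
    (hz : z ∈ Set.Icc p q)
    (hc : ∀ y ∈ Set.Icc p q, (c : EReal) ≤ clarkeLower h y (Pi.single j 1)) :
    c * (q j - p j) ≤ h (Function.update z j (q j)) - h (Function.update z j (p j)) := by
  refine mul_sub_le_sub_of_eventually_lt_quotient (f := fun x => h (Function.update z j x))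
    ((hz.1 j).trans (hz.2 j)) (continuousOn_comp_update hh hz j) fun x hx r hr => ?_
  simp only [update_add_eq_add_smul_single]
  exact eventually_lt_quotient_of_le_clarkeLower (hc _ (update_mem_Icc hz hx)) hr

/-- Increment of `h` along an edge under an upper bound on the Clarke upper derivative. -/
theorem sub_update_le_mul_sub_of_clarkeUpper_le {n : ℕ} {p q z : Fin n → ℝ}
    {h : (Fin n → ℝ) → ℝ} {c : ℝ} {j : Fin n} (hh : ContinuousOn h (Set.Icc p q))
    (hz : z ∈ Set.Icc p q)
    (hc : ∀ y ∈ Set.Icc p q, clarkeUpper h y (Pi.single j 1) ≤ (c : EReal)) :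
    h (Function.update z j (q j)) - h (Function.update z j (p j)) ≤ c * (q j - p j) := by
  have key := mul_sub_le_sub_of_eventually_lt_quotient
    (f := fun x => -h (Function.update z j x)) (c := -c)
    ((hz.1 j).trans (hz.2 j)) (continuousOn_comp_update hh hz j).neg fun x hx r hr => by
      simp only [update_add_eq_add_smul_single]
      filter_upwards [eventually_quotient_lt_of_clarkeUpper_le
        (hc _ (update_mem_Icc hz hx)) (lt_neg_of_lt_neg hr)] with l hl
      rw [neg_sub_neg, ← neg_sub, neg_div]
      linarith
  linarith

/-- Edgewise increment bounds on a box add up along a path from `u` to `v`. -/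
theorem sum_le_sub_of_le_sub_update {n : ℕ} {p q u v d : Fin n → ℝ} {h : (Fin n → ℝ) → ℝ}
    (hu : u ∈ Set.Icc p q) (hv : v ∈ Set.Icc p q)
    (hd : ∀ j, ∀ z ∈ Set.Icc p q,
      d j ≤ h (Function.update z j (v j)) - h (Function.update z j (u j))) :
    ∑ j, d j ≤ h v - h u := by
  have key : ∀ s : Finset (Fin n), ∑ j ∈ s, d j ≤ h (s.piecewise v u) - h u := by
    intro s
    induction s using Finset.induction_on with
    | empty => simp
    | insert a s ha ih =>
      have hz : s.piecewise v u ∈ Set.Icc p q :=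
        ⟨Finset.le_piecewise_of_le_of_le _ hv.1 hu.1, Finset.piecewise_le_of_le_of_le _ hv.2 hu.2⟩
      have h₁ := hd a _ hz
      have h₂ : Function.update (s.piecewise v u) a (u a) = s.piecewise v u := by
        rw [Function.update_eq_self_iff, Finset.piecewise_eq_of_notMem _ _ _ ha]
      rw [h₂] at h₁
      rw [Finset.sum_insert ha, Finset.piecewise_insert]
      linarith
  simpa using key Finset.univ

/-- Core of Lemma 3: increment bound for admissible remainder functions.
The increment of `h` between the opposite vertices `ζ⁻, ζ⁺` of the box is at least
`∑ j, m j * (ζ⁻ j - ζ⁺ j)`, and this quantity equals `∑ j, |m j| * (q j - p j)`. -/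
theorem stmt_11 {n : ℕ} (p q : Fin n → ℝ) (hpq : p ≤ q)
    (h : (Fin n → ℝ) → ℝ) (hhc : ContinuousOn h (Set.Icc p q))
    (m : Fin n → ℝ) (S : Set (Fin n)) [DecidablePred (· ∈ S)]
    (hmS : ∀ j ∈ S, 0 ≤ m j) (hmS' : ∀ j ∉ S, m j ≤ 0)
    (hlo : ∀ j ∈ S, ∀ z ∈ Set.Icc p q,
      ((m j : ℝ) : EReal) ≤ clarkeLower h z (Pi.single j 1))
    (hup : ∀ j ∉ S, ∀ z ∈ Set.Icc p q,
      clarkeUpper h z (Pi.single j 1) ≤ ((m j : ℝ) : EReal)) :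
    let ζm : Fin n → ℝ := fun j => if j ∈ S then q j else p j
    let ζp : Fin n → ℝ := fun j => if j ∈ S then p j else q j
    (∑ j, m j * (ζm j - ζp j)) ≤ h ζm - h ζp ∧
    (∑ j, m j * (ζm j - ζp j)) = ∑ j, |m j| * (q j - p j) := by
  intro ζm ζp
  have hm : ζm ∈ Set.Icc p q := by
    constructor <;> intro j <;> by_cases hj : j ∈ S <;> simp [ζm, hj, hpq j]
  have hp : ζp ∈ Set.Icc p q := by
    constructor <;> intro j <;> by_cases hj : j ∈ S <;> simp [ζp, hj, hpq j]
  constructor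
  · refine sum_le_sub_of_le_sub_update hp hm fun j z hz => ?_
    by_cases hj : j ∈ S
    · simpa only [ζm, ζp, if_pos hj] using
        mul_sub_le_sub_update_of_le_clarkeLower hhc hz (hlo j hj)
    · have := sub_update_le_mul_sub_of_clarkeUpper_le hhc hz (hup j hj)
      simp only [ζm, ζp, if_neg hj]
      linarith
  · refine Finset.sum_congr rfl fun j _ => ?_
    by_cases hj : j ∈ S
    · simp only [ζm, ζp, if_pos hj, abs_of_nonneg (hmS j hj)]
    · simp only [ζm, ζp, if_neg hj, abs_of_nonpos (hmS' j hj)]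
      ring
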